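/- arXiv:0905.1885 — 3 statements merged into one kernel-verified Lean document; each statement's English description precedes it below -/
import Mathlib

section
/- For every element g ∈ G there is a unique canonical tuple b such that g is automorphic to some element of type T(b). Moreover, if a is the tuple with g ∈ T(a), then a ≤ b componentwise; that is, every canonical tuple is the componentwise maximum among the tuples of all types meeting its automorphism class. -/
/-- A tuple `a` is canonical (w.r.t. the exponents `lam`) if `a` is weakly increasing and
`a (i+1) - a i ≤ lam (i+1) - lam i` for adjacent coordinates (written additively). -/
def IsCanonical {n : ℕ} (lam a : Fin n → ℕ) : Prop :=
  ∀ i j : Fin n, (i : ℕ) + 1 = (j : ℕ) → a i ≤ a j ∧ a j + lam i ≤ a i + lam j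

/-- The defining inequalities of a canonical tuple propagate from adjacent to all coordinates. -/
theorem IsCanonical.of_le {n : ℕ} {lam b : Fin n → ℕ} (hb : IsCanonical lam b) {i j : Fin n}
    (hij : i ≤ j) : b i ≤ b j ∧ b j + lam i ≤ b i + lam j := by
  obtain ⟨d, hd⟩ := Nat.exists_eq_add_of_le (Fin.le_def.mp hij)
  clear hij
  induction d generalizing j with
  | zero =>
    obtain rfl : j = i := Fin.ext (by omega)
    exact ⟨le_rfl, le_rfl⟩
  | succ d ih =>
    have hk := ih (j := ⟨i + d, by omega⟩) rfl
    have hkj := hb ⟨i + d, by omega⟩ j (by simp only; omega)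
    omega

namespace ZMod

theorem exists_addOrderOf_eq_prime_pow {p : ℕ} (hp : p.Prime) {k : ℕ} (x : ZMod (p ^ k)) :
    ∃ a ≤ k, addOrderOf x = p ^ a := by
  refine (Nat.dvd_prime_pow hp).mp (addOrderOf_dvd_of_nsmul_eq_zero ?_)
  rw [nsmul_eq_mul, ZMod.natCast_self, zero_mul]

theorem pow_nsmul_natCast_eq_zero_iff {p k t v : ℕ} :
    p ^ t • (v : ZMod (p ^ k)) = 0 ↔ p ^ k ∣ p ^ t * v := by
  rw [nsmul_eq_mul, ← Nat.cast_mul, ZMod.natCast_eq_zero_iff]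

/-- If `b ≤ c` or `b + l ≤ c + k`, then homomorphisms send the `p ^ b`-torsion of `ZMod (p ^ k)`
into the `p ^ c`-torsion of `ZMod (p ^ l)`. -/
theorem pow_nsmul_map_eq_zero {p k l b c : ℕ} (hp : p.Prime) (f : ZMod (p ^ k) →+ ZMod (p ^ l))
    (hbk : b ≤ k) (h : b ≤ c ∨ b + l ≤ c + k) {x : ZMod (p ^ k)} (hx : p ^ b • x = 0) :
    p ^ c • f x = 0 := by
  rcases h with h | h
  · rw [← Nat.sub_add_cancel h, pow_add, mul_smul, ← map_nsmul f (p ^ b), hx, map_zero, smul_zero]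
  · have : NeZero (p ^ k) := ⟨pow_ne_zero _ hp.ne_zero⟩
    obtain ⟨v, rfl⟩ := ZMod.natCast_zmod_surjective x
    rw [pow_nsmul_natCast_eq_zero_iff, ← Nat.add_sub_cancel' hbk, pow_add] at hx
    obtain ⟨w, rfl⟩ := Nat.dvd_of_mul_dvd_mul_left (pow_pos hp.pos b) hx
    have hw : ((p ^ (k - b) * w : ℕ) : ZMod (p ^ k)) = p ^ (k - b) • (w : ZMod (p ^ k)) := by
      rw [nsmul_eq_mul, Nat.cast_mul]
    obtain ⟨d, hd⟩ : ∃ d, c + (k - b) = d + l := ⟨c + (k - b) - l, by omega⟩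
    rw [hw, map_nsmul, smul_smul, ← pow_add, hd, pow_add, mul_smul, nsmul_eq_mul (p ^ l),
      ZMod.natCast_self, zero_mul, smul_zero]

theorem exists_injective_addMonoidHom_of_le {p k l : ℕ} (hp : p.Prime) (h : k ≤ l) :
    ∃ f : ZMod (p ^ k) →+ ZMod (p ^ l), Function.Injective f := by
  have hz : zmultiplesHom (ZMod (p ^ l)) ((p ^ (l - k) : ℕ) : ZMod (p ^ l)) ((p ^ k : ℕ) : ℤ)
      = 0 := by
    rw [zmultiplesHom_apply, natCast_zsmul, nsmul_eq_mul, ← Nat.cast_mul, ← pow_add,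
      Nat.add_sub_cancel' h, ZMod.natCast_self]
  refine ⟨ZMod.lift (p ^ k) ⟨_, hz⟩, (ZMod.lift_injective _).mpr fun m hm => ?_⟩
  rw [zmultiplesHom_apply, zsmul_eq_mul, ← Int.cast_natCast, ← Int.cast_mul,
    ZMod.intCast_zmod_eq_zero_iff_dvd] at hm
  rw [ZMod.intCast_zmod_eq_zero_iff_dvd]
  refine Int.dvd_of_mul_dvd_mul_right (a := ((p ^ (l - k) : ℕ) : ℤ)) ?_ ?_
  · exact_mod_cast pow_ne_zero _ hp.ne_zero
  · rwa [← Nat.cast_mul, ← pow_add, Nat.add_sub_cancel' h]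

theorem pow_nsmul_castHom_eq_zero {p k l t : ℕ} (hp : p.Prime) (h : l ≤ k) {x : ZMod (p ^ k)}
    (hx : p ^ t • ZMod.castHom (pow_dvd_pow p h) (ZMod (p ^ l)) x = 0) :
    p ^ (t + (k - l)) • x = 0 := by
  have : NeZero (p ^ k) := ⟨pow_ne_zero _ hp.ne_zero⟩
  obtain ⟨v, rfl⟩ := ZMod.natCast_zmod_surjective x
  rw [map_natCast, pow_nsmul_natCast_eq_zero_iff] at hx
  rw [pow_nsmul_natCast_eq_zero_iff, pow_add, mul_right_comm]
  nth_rewrite 1 [← Nat.add_sub_cancel' h]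
  rw [pow_add]
  exact mul_dvd_mul_right hx _

end ZMod

/-- The automorphism of a product of abelian groups adding the image of the `j`-th coordinate
to the `i`-th one. -/
def AddAut.piTransvection {ι : Type*} [DecidableEq ι] {A : ι → Type*} [∀ i, AddCommGroup (A i)]
    {i j : ι} (hij : i ≠ j) (f : A j →+ A i) : AddAut (Π i, A i) where
  toFun x := x + Pi.single i (f (x j))
  invFun x := x - Pi.single i (f (x j))
  left_inv x := by simp [Pi.single_eq_of_ne hij.symm]
  right_inv x := by simp [Pi.single_eq_of_ne hij.symm]
  map_add' x y := by
    rw [Pi.add_apply, map_add, Pi.single_add]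
    abel

/-- If the orders of the coordinates of `x` are maximal in its automorphism class, then a
homomorphism between two coordinates cannot raise the order. -/
theorem addOrderOf_nsmul_map_eq_zero_of_maximal {p n : ℕ} (hp : p.Prime) {lam : Fin n → ℕ}
    {x : Π i : Fin n, ZMod (p ^ lam i)}
    (hmax : ∀ φ : AddAut (Π i : Fin n, ZMod (p ^ lam i)),
      ∑ i, addOrderOf (φ x i) ≤ ∑ i, addOrderOf (x i))
    {i j : Fin n} (hij : i ≠ j) (f : ZMod (p ^ lam j) →+ ZMod (p ^ lam i)) :
    addOrderOf (x i) • f (x j) = 0 := by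
  by_contra hne
  refine (hmax (AddAut.piTransvection hij f)).not_gt
    (Finset.sum_lt_sum (fun k _ => ?_) ⟨i, Finset.mem_univ i, ?_⟩)
  all_goals
    have hlt : addOrderOf (x i) < addOrderOf (AddAut.piTransvection hij f x i) := by
      have happ : AddAut.piTransvection hij f x i = x i + f (x j) := by
        simp [AddAut.piTransvection]
      rw [happ]
      obtain ⟨a, -, ha⟩ := ZMod.exists_addOrderOf_eq_prime_pow hp (x i)
      obtain ⟨c, -, hc⟩ := ZMod.exists_addOrderOf_eq_prime_pow hp (x i + f (x j))
      rw [ha, hc]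
      by_contra hle
      refine hne ?_
      have hzero : addOrderOf (x i) • (x i + f (x j)) = 0 := by
        rw [← addOrderOf_dvd_iff_nsmul_eq_zero, ha, hc]
        exact pow_dvd_pow p ((Nat.pow_le_pow_iff_right hp.one_lt).mp (not_lt.mp hle))
      rwa [smul_add, addOrderOf_nsmul_eq_zero, zero_add] at hzero
  · obtain rfl | hki := eq_or_ne k i
    · exact hlt.le
    · simp [AddAut.piTransvection, Pi.single_eq_of_ne hki]
  · exact hlt

theorem isCanonical_of_maximal {p n : ℕ} (hp : p.Prime) {lam : Fin n → ℕ} (hlam : Monotone lam)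
    {x : Π i : Fin n, ZMod (p ^ lam i)}
    (hmax : ∀ φ : AddAut (Π i : Fin n, ZMod (p ^ lam i)),
      ∑ i, addOrderOf (φ x i) ≤ ∑ i, addOrderOf (x i))
    {a : Fin n → ℕ} (ha : ∀ i, addOrderOf (x i) = p ^ a i) : IsCanonical lam a := by
  intro i j hij
  have hne : i ≠ j := by rintro rfl; omega
  have hle : lam i ≤ lam j := hlam (Fin.le_def.mpr (by omega))
  have le_of_nsmul {k : Fin n} {t : ℕ} (h : p ^ t • x k = 0) : a k ≤ t := by
    rw [← addOrderOf_dvd_iff_nsmul_eq_zero, ha] at h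
    exact (Nat.pow_dvd_pow_iff_le_right hp.one_lt).mp h
  constructor
  · obtain ⟨f, hf⟩ := ZMod.exists_injective_addMonoidHom_of_le hp hle
    have h := addOrderOf_nsmul_map_eq_zero_of_maximal hp hmax hne.symm f
    rw [ha, ← map_nsmul, map_eq_zero_iff f hf] at h
    exact le_of_nsmul h
  · have h := addOrderOf_nsmul_map_eq_zero_of_maximal hp hmax hne
      (ZMod.castHom (pow_dvd_pow p hle) (ZMod (p ^ lam i))).toAddMonoidHom
    rw [ha] at h
    have := le_of_nsmul (ZMod.pow_nsmul_castHom_eq_zero hp hle h)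
    omega

/-- A canonical tuple bounds the types of all endomorphic images of an element of that type. -/
theorem IsCanonical.le_of_addMonoidHom {p n : ℕ} (hp : p.Prime) {lam : Fin n → ℕ}
    {x : Π i : Fin n, ZMod (p ^ lam i)} {a b : Fin n → ℕ}
    (hb : ∀ i, b i ≤ lam i) (hcan : IsCanonical lam b) (hx : ∀ i, addOrderOf (x i) = p ^ b i)
    (f : (Π i : Fin n, ZMod (p ^ lam i)) →+ (Π i : Fin n, ZMod (p ^ lam i)))
    (ha : ∀ i, addOrderOf (f x i) = p ^ a i) (i : Fin n) : a i ≤ b i := by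
  rw [← Nat.pow_dvd_pow_iff_le_right hp.one_lt, ← ha i, addOrderOf_dvd_iff_nsmul_eq_zero,
    ← Finset.univ_sum_single x, map_sum, Finset.sum_apply, Finset.smul_sum]
  refine Finset.sum_eq_zero fun j _ => ?_
  refine ZMod.pow_nsmul_map_eq_zero hp
    (((Pi.evalAddMonoidHom (fun i => ZMod (p ^ lam i)) i).comp f).comp
      (AddMonoidHom.single (fun i => ZMod (p ^ lam i)) j)) (hb j) ?_ (hx j ▸ addOrderOf_nsmul_eq_zero (x j))
  rcases le_total j i with h | h
  · exact .inl (hcan.of_le h).1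
  · exact .inr (hcan.of_le h).2

theorem stmt_3 (p : ℕ) (hp : p.Prime) (n : ℕ) (hn : 0 < n)
    (lam : Fin n → ℕ) (hlam1 : ∀ i, 1 ≤ lam i) (hlam : Monotone lam) :
    (∀ g : Π i : Fin n, ZMod (p ^ lam i),
      ∃! b : Fin n → ℕ, (∀ i, b i ≤ lam i) ∧ IsCanonical lam b ∧
        ∃ φ : AddAut (Π i : Fin n, ZMod (p ^ lam i)),
          ∀ i, addOrderOf (φ g i) = p ^ b i) ∧
    (∀ (g : Π i : Fin n, ZMod (p ^ lam i)) (a b : Fin n → ℕ),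
      (∀ i, addOrderOf (g i) = p ^ a i) →
      (∀ i, b i ≤ lam i) → IsCanonical lam b →
      (∃ φ : AddAut (Π i : Fin n, ZMod (p ^ lam i)),
        ∀ i, addOrderOf (φ g i) = p ^ b i) →
      ∀ i, a i ≤ b i) := by
  have bound (g : Π i : Fin n, ZMod (p ^ lam i)) (a b : Fin n → ℕ)
      (ha : ∀ i, addOrderOf (g i) = p ^ a i) (hb : ∀ i, b i ≤ lam i) (hcan : IsCanonical lam b)
      (φ : AddAut (Π i : Fin n, ZMod (p ^ lam i))) (hφ : ∀ i, addOrderOf (φ g i) = p ^ b i)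
      (i : Fin n) : a i ≤ b i := by
    refine hcan.le_of_addMonoidHom hp hb hφ (AddEquiv.symm φ).toAddMonoidHom (fun i => ?_) i
    rw [← ha i]
    exact congrArg (fun x => addOrderOf (x i)) (AddEquiv.symm_apply_apply φ g)
  refine ⟨fun g => ?_, fun g a b ha hb hcan ⟨φ, hφ⟩ => bound g a b ha hb hcan φ hφ⟩
  have (i : Fin n) : NeZero (p ^ lam i) := ⟨pow_ne_zero _ hp.ne_zero⟩
  have : Finite (AddAut (Π i : Fin n, ZMod (p ^ lam i))) :=
    DFunLike.finite _
  obtain ⟨φ, hφ⟩ := Finite.exists_max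
    fun φ : AddAut (Π i : Fin n, ZMod (p ^ lam i)) => ∑ i, addOrderOf (φ g i)
  choose b hb hord using fun i => ZMod.exists_addOrderOf_eq_prime_pow hp (φ g i)
  have hcan : IsCanonical lam b :=
    isCanonical_of_maximal hp hlam (fun ψ => hφ (AddEquiv.trans φ ψ)) hord
  refine ⟨b, ⟨hb, hcan, φ, hord⟩, fun c ⟨hc, hccan, ψ, hψ⟩ => funext fun i => le_antisymm ?_ ?_⟩
  · refine bound (ψ g) c b hψ hb hcan (AddEquiv.trans (AddEquiv.symm ψ) φ) (fun i => ?_) i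
    rw [← hord i]
    exact congrArg (fun x => addOrderOf (φ x i)) (AddEquiv.symm_apply_apply ψ g)
  · refine bound (φ g) b c hord hc hccan (AddEquiv.trans (AddEquiv.symm φ) ψ) (fun i => ?_) i
    rw [← hψ i]
    exact congrArg (fun x => addOrderOf (ψ x i)) (AddEquiv.symm_apply_apply φ g)
end

section
/- Suppose p is an odd prime. Then the map a ↦ R(a) is an order isomorphism from the set of canonical tuples, ordered componentwise, onto the set of characteristic subgroups of G, ordered by inclusion. In particular, the lattice of characteristic subgroups of G is distributive: for all characteristic subgroups A, B, C of G, A ∩ (B ⊔ C) = (A ∩ B) ⊔ (A ∩ C), where ⊔ denotes the subgroup join. -/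
/-- A subgroup is characteristic if it is mapped onto itself by every automorphism. -/
def IsCharSub {G : Type*} [AddGroup G] (H : AddSubgroup G) : Prop :=
  ∀ φ : AddAut G, AddSubgroup.map φ.toAddMonoidHom H = H

/-- The regular subgroup `R(a)`: elements whose `i`-th component is killed by `p ^ a i`. -/
def regSub (p : ℕ) {n : ℕ} (lam a : Fin n → ℕ) :
    AddSubgroup (Π i : Fin n, ZMod (p ^ lam i)) where
  carrier := {g | ∀ i, (p ^ a i : ℕ) • g i = 0}
  zero_mem' := by intro i; simp
  add_mem' := by
    intro x y hx hy i
    have : (p ^ a i : ℕ) • (x i + y i) = 0 := by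
      rw [smul_add, hx i, hy i, add_zero]
    simpa using this
  neg_mem' := by
    intro x hx i
    have : (p ^ a i : ℕ) • (-x i) = 0 := by
      rw [smul_neg, hx i, neg_zero]
    simpa using this

section CyclicPrimePower

variable {p : ℕ}

theorem natCast_pow_eq_zero_iff (hp : p.Prime) (m k : ℕ) :
    ((p ^ k : ℕ) : ZMod (p ^ m)) = 0 ↔ m ≤ k := by
  rw [ZMod.natCast_eq_zero_iff, Nat.pow_dvd_pow_iff_le_right hp.one_lt]

theorem pow_nsmul_eq_zero_of_le {m k : ℕ} (h : m ≤ k) (x : ZMod (p ^ m)) :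
    (p ^ k : ℕ) • x = 0 := by
  rw [nsmul_eq_mul, (ZMod.natCast_eq_zero_iff _ _).2 (pow_dvd_pow p h), zero_mul]

theorem pow_nsmul_pow_eq_zero_iff (hp : p.Prime) (m k l : ℕ) :
    (p ^ k : ℕ) • ((p ^ l : ℕ) : ZMod (p ^ m)) = 0 ↔ m ≤ k + l := by
  rw [nsmul_eq_mul, ← Nat.cast_mul, ← pow_add, natCast_pow_eq_zero_iff hp]

theorem exists_eq_pow_nsmul_of_pow_nsmul_eq_zero (hp : p.Prime) {m a : ℕ} (h : a ≤ m)
    {x : ZMod (p ^ m)} (hx : (p ^ a : ℕ) • x = 0) :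
    ∃ y : ZMod (p ^ m), x = (p ^ (m - a) : ℕ) • y := by
  have := Fact.mk hp
  obtain ⟨k, rfl⟩ := ZMod.natCast_zmod_surjective x
  rw [nsmul_eq_mul, ← Nat.cast_mul, ZMod.natCast_eq_zero_iff] at hx
  have hdvd : p ^ (m - a) ∣ k := by
    apply Nat.dvd_of_mul_dvd_mul_left (pow_pos hp.pos a)
    rwa [← pow_add, Nat.add_sub_cancel' h]
  obtain ⟨c, rfl⟩ := hdvd
  exact ⟨c, by simp [nsmul_eq_mul]⟩

theorem exists_mem_iff_pow_nsmul_eq_zero (hp : p.Prime) {m : ℕ} (K : AddSubgroup (ZMod (p ^ m))) :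
    ∃ a ≤ m, ∀ x, x ∈ K ↔ (p ^ a : ℕ) • x = 0 := by
  classical
  have := Fact.mk hp
  have hdvd : Nat.card K ∣ p ^ m := by
    simpa using AddSubgroup.card_addSubgroup_dvd_card K
  obtain ⟨a, ham, ha⟩ := (Nat.dvd_prime_pow hp).1 hdvd
  refine ⟨a, ham, ?_⟩
  have hsub : ∀ x ∈ K, (p ^ a : ℕ) • x = 0 := fun x hx => by
    have := card_nsmul_eq_zero' (x := (⟨x, hx⟩ : K))
    rw [ha] at this
    simpa using congrArg Subtype.val this
  have hcard : (Finset.univ.filter fun x : ZMod (p ^ m) => (p ^ a : ℕ) • x = 0).card ≤ p ^ a :=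
    IsAddCyclic.card_nsmul_eq_zero_le (pow_pos hp.pos a)
  have heq : (Finset.univ.filter fun x : ZMod (p ^ m) => x ∈ K) =
      Finset.univ.filter fun x : ZMod (p ^ m) => (p ^ a : ℕ) • x = 0 := by
    apply Finset.eq_of_subset_of_card_le
    · intro x hx
      simpa using hsub x (by simpa using hx)
    · refine hcard.trans (le_of_eq ?_)
      rw [← ha, Nat.card_eq_fintype_card, Fintype.card_subtype]
  intro x
  simpa using Finset.ext_iff.1 heq x

end CyclicPrimePower

theorem IsCharSub.apply_mem {G : Type*} [AddGroup G] {H : AddSubgroup G} (hH : IsCharSub H)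
    (φ : AddAut G) {x : G} (hx : x ∈ H) : φ x ∈ H := by
  have h : φ x ∈ AddSubgroup.map φ.toAddMonoidHom H := ⟨x, hx, rfl⟩
  rwa [hH φ] at h

theorem isCharSub_of_forall_hom {G : Type*} [AddGroup G] {H : AddSubgroup G}
    (h : ∀ φ : G →+ G, ∀ x ∈ H, φ x ∈ H) : IsCharSub H := by
  intro φ
  ext x
  constructor
  · rintro ⟨y, hy, rfl⟩
    exact h _ y hy
  · intro hx
    exact ⟨φ.symm x, h φ.symm.toAddMonoidHom x hx, φ.apply_symm_apply x⟩

section Product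

variable {ι : Type*} [DecidableEq ι] {M : ι → Type*} [∀ i, AddCommGroup (M i)]

/-- The automorphism of a product that adds to the `j`-th coordinate the image of the
`i`-th coordinate under `f`, for `i ≠ j`. -/
def transvectionAut {i j : ι} (hij : i ≠ j) (f : M i →+ M j) : AddAut (Π k, M k) where
  toFun x := x + Pi.single j (f (x i))
  invFun x := x - Pi.single j (f (x i))
  left_inv x := by simp [hij]
  right_inv x := by simp [hij]
  map_add' x y := by
    simp only [Pi.add_apply, map_add, Pi.single_add]
    abel

/-- The automorphism of a product that negates the `i`-th coordinate. -/
def negCoordAut (i : ι) : AddAut (Π k, M k) where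
  toFun x := x - (2 : ℕ) • Pi.single i (x i)
  invFun x := x - (2 : ℕ) • Pi.single i (x i)
  left_inv x := by
    ext k
    rcases eq_or_ne k i with rfl | hk
    · simp [two_nsmul]
    · simp [hk]
  right_inv x := by
    ext k
    rcases eq_or_ne k i with rfl | hk
    · simp [two_nsmul]
    · simp [hk]
  map_add' x y := by
    simp only [Pi.add_apply, Pi.single_add, nsmul_add]
    abel

theorem IsCharSub.single_hom_mem {H : AddSubgroup (Π k, M k)} (hH : IsCharSub H) {i j : ι}
    (hij : i ≠ j) (f : M i →+ M j) {x : Π k, M k} (hx : x ∈ H) :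
    Pi.single j (f (x i)) ∈ H := by
  have h : x + Pi.single j (f (x i)) ∈ H := hH.apply_mem (transvectionAut hij f) hx
  simpa using H.sub_mem h hx

theorem IsCharSub.two_nsmul_single_mem {H : AddSubgroup (Π k, M k)} (hH : IsCharSub H) (i : ι)
    {x : Π k, M k} (hx : x ∈ H) : (2 : ℕ) • Pi.single i (x i) ∈ H := by
  have h : x - (2 : ℕ) • Pi.single i (x i) ∈ H := hH.apply_mem (negCoordAut i) hx
  simpa using H.sub_mem hx h

theorem mem_of_forall_single_mem [Fintype ι] {H : AddSubgroup (Π k, M k)} {x : Π k, M k}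
    (h : ∀ i, Pi.single i (x i) ∈ H) : x ∈ H := by
  rw [← Finset.univ_sum_single x]
  exact H.sum_mem fun i _ => h i

end Product

theorem IsCanonical.le_and_le {n : ℕ} {lam a : Fin n → ℕ} (ha : IsCanonical lam a)
    {i j : Fin n} (hij : i ≤ j) : a i ≤ a j ∧ a j + lam i ≤ a i + lam j := by
  obtain ⟨i, hi⟩ := i
  obtain ⟨j, hj⟩ := j
  have hij' : i ≤ j := hij
  clear hij
  induction j, hij' using Nat.le_induction with
  | base => exact ⟨le_rfl, le_rfl⟩
  | succ k hk ih =>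
    have h1 := ih (by omega)
    have h2 := ha ⟨k, by omega⟩ ⟨k + 1, hj⟩ rfl
    omega

/-- The homomorphism between cyclic groups of prime power order that sends `1` to the smallest
power of `p` for which it is well defined. -/
def zmodPowHom (p l m : ℕ) : ZMod (p ^ l) →+ ZMod (p ^ m) :=
  ZMod.lift (p ^ l) ⟨(zmultiplesHom (ZMod (p ^ m))) ((p ^ (m - l) : ℕ) : ZMod (p ^ m)), by
    have h : (p ^ l : ℕ) • ((p ^ (m - l) : ℕ) : ZMod (p ^ m)) = 0 := by
      rw [nsmul_eq_mul, ← Nat.cast_mul, ← pow_add, ZMod.natCast_eq_zero_iff]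
      exact pow_dvd_pow p (by omega)
    rw [zmultiplesHom_apply, natCast_zsmul]
    exact h⟩

theorem zmodPowHom_natCast (p l m k : ℕ) :
    zmodPowHom p l m (k : ZMod (p ^ l)) = ((k * p ^ (m - l) : ℕ) : ZMod (p ^ m)) := by
  have h : zmodPowHom p l m ((k : ℤ) : ZMod (p ^ l)) = _ := ZMod.lift_coe _ _ _
  rw [Int.cast_natCast] at h
  rw [h]
  simp

section RegSub

variable {p n : ℕ} {lam : Fin n → ℕ}

theorem mem_regSub {a : Fin n → ℕ} {x : Π i, ZMod (p ^ lam i)} :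
    x ∈ regSub p lam a ↔ ∀ i, (p ^ a i : ℕ) • x i = 0 := Iff.rfl

theorem single_mem_regSub_iff {a : Fin n → ℕ} {i : Fin n} {x : ZMod (p ^ lam i)} :
    Pi.single i x ∈ regSub p lam a ↔ (p ^ a i : ℕ) • x = 0 := by
  rw [mem_regSub]
  constructor
  · intro h
    simpa using h i
  · intro h j
    rcases eq_or_ne j i with rfl | hj
    · simpa using h
    · simp [hj]

theorem single_pow_mem_regSub {a : Fin n → ℕ} (hp : p.Prime) {i : Fin n} :
    Pi.single i ((p ^ (lam i - a i) : ℕ) : ZMod (p ^ lam i)) ∈ regSub p lam a := by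
  rw [single_mem_regSub_iff, pow_nsmul_pow_eq_zero_iff hp]
  omega

theorem regSub_le_regSub_iff (hp : p.Prime) {a b : Fin n → ℕ} (ha : ∀ i, a i ≤ lam i) :
    regSub p lam a ≤ regSub p lam b ↔ a ≤ b := by
  constructor
  · intro h i
    have h1 := h (single_pow_mem_regSub hp (i := i))
    rw [single_mem_regSub_iff, pow_nsmul_pow_eq_zero_iff hp] at h1
    have := ha i
    change a i ≤ b i
    omega
  · intro h x hx i
    rw [← Nat.sub_add_cancel (h i), pow_add, mul_smul, hx i, smul_zero]

theorem IsCanonical.isCharSub_regSub (hp : p.Prime) {a : Fin n → ℕ} (ha : ∀ i, a i ≤ lam i)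
    (hc : IsCanonical lam a) : IsCharSub (regSub p lam a) := by
  apply isCharSub_of_forall_hom
  intro φ x hx
  rw [← Finset.univ_sum_single x, map_sum]
  refine AddSubgroup.sum_mem _ fun i _ j => ?_
  let f : ZMod (p ^ lam i) →+ ZMod (p ^ lam j) :=
    (Pi.evalAddMonoidHom _ j).comp (φ.comp (AddMonoidHom.single _ i))
  change (p ^ a j : ℕ) • f (x i) = 0
  rcases le_total i j with hij | hji
  · rw [← Nat.sub_add_cancel (hc.le_and_le hij).1, pow_add, mul_smul, ← map_nsmul, hx i, map_zero,
      smul_zero]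
  · obtain ⟨y, hy⟩ := exists_eq_pow_nsmul_of_pow_nsmul_eq_zero hp (ha i) (hx i)
    rw [hy, map_nsmul, ← mul_smul, ← pow_add]
    apply pow_nsmul_eq_zero_of_le
    have := (hc.le_and_le hji).2
    have := ha i
    omega

theorem IsCharSub.single_mem (hp : p.Prime) (hodd : p ≠ 2)
    {H : AddSubgroup (Π i, ZMod (p ^ lam i))} (hH : IsCharSub H) (i : Fin n)
    {x : Π i, ZMod (p ^ lam i)} (hx : x ∈ H) : Pi.single i (x i) ∈ H := by
  obtain ⟨m, hm⟩ := (hp.odd_of_ne_two hodd).pow (n := lam i)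
  have h := H.nsmul_mem (hH.two_nsmul_single_mem i hx) (m + 1)
  have hz : (p ^ lam i : ℕ) • (Pi.single i (x i) : Π i, ZMod (p ^ lam i)) = 0 := by
    rw [← Pi.single_smul, pow_nsmul_eq_zero_of_le le_rfl, Pi.single_zero]
  rwa [← mul_smul, show (m + 1) * 2 = p ^ lam i + 1 by omega, add_smul, hz, zero_add,
    one_smul] at h

theorem IsCharSub.exists_eq_regSub (hp : p.Prime) (hodd : p ≠ 2) (hlam : Monotone lam)
    {H : AddSubgroup (Π i, ZMod (p ^ lam i))} (hH : IsCharSub H) :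
    ∃ a : Fin n → ℕ, (∀ i, a i ≤ lam i) ∧ IsCanonical lam a ∧ regSub p lam a = H := by
  choose a ha hmem using fun i : Fin n =>
    exists_mem_iff_pow_nsmul_eq_zero hp (H.comap (AddMonoidHom.single (fun k => ZMod (p ^ lam k)) i))
  have hmem' : ∀ i x, Pi.single i x ∈ H ↔ (p ^ a i : ℕ) • x = 0 := hmem
  have key : ∀ i j, i ≠ j → lam j ≤ a j + (lam i - a i + (lam j - lam i)) := by
    intro i j hij
    have h1 : Pi.single i ((p ^ (lam i - a i) : ℕ) : ZMod (p ^ lam i)) ∈ H := by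
      rw [hmem', pow_nsmul_pow_eq_zero_iff hp]
      omega
    have h2 := hH.single_hom_mem hij (zmodPowHom p (lam i) (lam j)) h1
    rwa [Pi.single_eq_same, zmodPowHom_natCast, ← pow_add, hmem',
      pow_nsmul_pow_eq_zero_iff hp] at h2
  refine ⟨a, ha, ?_, ?_⟩
  · intro i j hij
    have hne : i ≠ j := by
      rintro rfl
      omega
    have hle : lam i ≤ lam j := hlam (Fin.le_def.2 (by omega))
    have h1 := key i j hne
    have h2 := key j i hne.symm
    have := ha i
    have := ha j
    omega
  · ext x
    constructor
    · intro hx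
      exact mem_of_forall_single_mem fun i => (hmem' i _).2 (hx i)
    · intro hx i
      exact (hmem' i _).1 (hH.single_mem hp hodd i hx)

theorem regSub_inf_sup_le (a b c : Fin n → ℕ) :
    regSub p lam a ⊓ (regSub p lam b ⊔ regSub p lam c) ≤
      (regSub p lam a ⊓ regSub p lam b) ⊔ (regSub p lam a ⊓ regSub p lam c) := by
  rintro x ⟨hxa, hx⟩
  obtain ⟨y, hy, z, hz, rfl⟩ := AddSubgroup.mem_sup.1 hx
  apply mem_of_forall_single_mem
  intro i
  have lift : ∀ {k l : ℕ} {w : ZMod (p ^ lam i)}, k ≤ l → (p ^ k : ℕ) • w = 0 →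
      (p ^ l : ℕ) • w = 0 := by
    intro k l w hkl hw
    rw [← Nat.sub_add_cancel hkl, pow_add, mul_smul, hw, smul_zero]
  rcases le_total (b i) (c i) with h | h
  · refine AddSubgroup.mem_sup_right
      ⟨single_mem_regSub_iff.2 (hxa i), single_mem_regSub_iff.2 ?_⟩
    rw [Pi.add_apply, smul_add, lift h (hy i), hz i, add_zero]
  · refine AddSubgroup.mem_sup_left
      ⟨single_mem_regSub_iff.2 (hxa i), single_mem_regSub_iff.2 ?_⟩
    rw [Pi.add_apply, smul_add, lift h (hz i), hy i, add_zero]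

end RegSub

theorem stmt_8 (p : ℕ) (hp : p.Prime) (hodd : p ≠ 2) (n : ℕ) (hn : 0 < n)
    (lam : Fin n → ℕ) (hlam1 : ∀ i, 1 ≤ lam i) (hlam : Monotone lam) :
    (∃ e : {a : Fin n → ℕ // (∀ i, a i ≤ lam i) ∧ IsCanonical lam a} ≃o
        {H : AddSubgroup (Π i : Fin n, ZMod (p ^ lam i)) // IsCharSub H},
      ∀ a, (e a : AddSubgroup (Π i : Fin n, ZMod (p ^ lam i))) = regSub p lam a.1) ∧
    (∀ A B C : AddSubgroup (Π i : Fin n, ZMod (p ^ lam i)),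
      IsCharSub A → IsCharSub B → IsCharSub C →
      A ⊓ (B ⊔ C) = (A ⊓ B) ⊔ (A ⊓ C)) := by
  constructor
  · let f : {a : Fin n → ℕ // (∀ i, a i ≤ lam i) ∧ IsCanonical lam a} ↪o
        {H : AddSubgroup (Π i : Fin n, ZMod (p ^ lam i)) // IsCharSub H} :=
      OrderEmbedding.ofMapLEIff
        (fun a => ⟨regSub p lam a.1, a.2.2.isCharSub_regSub hp a.2.1⟩)
        (fun a _ => regSub_le_regSub_iff hp a.2.1)
    have hf : Function.Surjective f := by
      rintro ⟨H, hH⟩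
      obtain ⟨a, ha, hc, rfl⟩ := hH.exists_eq_regSub hp hodd hlam
      exact ⟨⟨a, ha, hc⟩, rfl⟩
    exact ⟨RelIso.ofSurjective f hf, fun _ => rfl⟩
  · intro A B C hA hB hC
    obtain ⟨a, -, -, rfl⟩ := hA.exists_eq_regSub hp hodd hlam
    obtain ⟨b, -, -, rfl⟩ := hB.exists_eq_regSub hp hodd hlam
    obtain ⟨c, -, -, rfl⟩ := hC.exists_eq_regSub hp hodd hlam
    exact le_antisymm (regSub_inf_sup_le a b c) le_inf_sup
end

section
/- Suppose 0 < λ_1 < λ_2 < ⋯ < λ_n (no repeated factors), and let a be a canonical tuple. Then for every tuple b with 0 ≤ b_i ≤ λ_i for all i, the elements of type T(b) are automorphic to the elements of type T(a) if and only if b ≤ a componentwise and b_i = a_i for every nondegenerate coordinate i of a. -/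
/-- A canonical tuple `a` is degenerate at coordinate `i` if `a i = a (i-1)`
(with the convention `a 0 = 0` before the first coordinate), or
`a (i+1) - a i = lam (i+1) - lam i` (written additively). -/
def DegenAt {n : ℕ} (lam a : Fin n → ℕ) (i : Fin n) : Prop :=
  ((i : ℕ) = 0 ∧ a i = 0) ∨
  (∃ j : Fin n, (j : ℕ) + 1 = (i : ℕ) ∧ a i = a j) ∨
  (∃ j : Fin n, (i : ℕ) + 1 = (j : ℕ) ∧ a j + lam i = a i + lam j)

/-- An element of additive order `p ^ c` in `ZMod (p ^ l)` is a unit multiple of `p ^ (l - c)`. -/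
theorem ZMod.exists_unit_mul_of_addOrderOf_eq {p : ℕ} (hp : p.Prime) {l c : ℕ} {x : ZMod (p ^ l)}
    (hx : addOrderOf x = p ^ c) :
    c ≤ l ∧ ∃ u : (ZMod (p ^ l))ˣ, x = (p : ZMod (p ^ l)) ^ (l - c) * u := by
  have : NeZero (p ^ l) := ⟨pow_ne_zero _ hp.ne_zero⟩
  have hcl : c ≤ l := by
    have h : addOrderOf x ∣ p ^ l := addOrderOf_dvd_of_nsmul_eq_zero (by simp)
    rw [hx] at h
    exact (Nat.pow_dvd_pow_iff_le_right hp.one_lt).1 h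
  refine ⟨hcl, ?_⟩
  have key (k : ℕ) : p ^ c ∣ p ^ k ↔ p ^ l ∣ p ^ k * x.val := by
    rw [← hx, addOrderOf_dvd_iff_nsmul_eq_zero, nsmul_eq_mul, ← ZMod.natCast_eq_zero_iff]
    simp
  rcases Nat.eq_zero_or_pos c with rfl | hc
  · have hx0 : x = 0 := by simpa using hx
    refine ⟨1, ?_⟩
    rw [hx0, Nat.sub_zero, Units.val_one, mul_one, ← Nat.cast_pow, ZMod.natCast_self]
  obtain ⟨t, ht⟩ : p ^ (l - c) ∣ x.val := by
    have h := (key c).1 dvd_rfl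
    have hpl : p ^ l = p ^ c * p ^ (l - c) := by rw [← pow_add, Nat.add_sub_cancel' hcl]
    exact Nat.dvd_of_mul_dvd_mul_left (pow_pos hp.pos c) (hpl.symm.dvd.trans h)
  have htp : ¬ p ∣ t := by
    rintro ⟨s, rfl⟩
    have h : p ^ l ∣ p ^ (c - 1) * x.val := by
      refine ⟨s, ?_⟩
      rw [ht, show l = (c - 1) + (l - c) + 1 by omega]
      rw [show c - 1 + (l - c) + 1 - c = l - c by omega]
      ring
    have := (Nat.pow_dvd_pow_iff_le_right hp.one_lt).1 ((key (c - 1)).2 h)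
    omega
  refine ⟨ZMod.unitOfCoprime t (((hp.coprime_iff_not_dvd).2 htp).symm.pow_right l), ?_⟩
  rw [ZMod.coe_unitOfCoprime, ← Nat.cast_pow, ← Nat.cast_mul, ← ht, ZMod.natCast_zmod_val]

theorem ZMod.exists_unit_mul_eq {p : ℕ} (hp : p.Prime) {l c : ℕ} {x y : ZMod (p ^ l)}
    (hx : addOrderOf x = p ^ c) (hy : addOrderOf y = p ^ c) :
    ∃ u : (ZMod (p ^ l))ˣ, u * x = y := by
  obtain ⟨-, u, hu⟩ := ZMod.exists_unit_mul_of_addOrderOf_eq hp hx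
  obtain ⟨-, v, hv⟩ := ZMod.exists_unit_mul_of_addOrderOf_eq hp hy
  refine ⟨v * u⁻¹, ?_⟩
  rw [hv, hu, mul_left_comm, Units.val_mul, mul_assoc, Units.inv_mul, mul_one]

/-- A homomorphism between cyclic `p`-groups with a prescribed value exists as soon as this value
is small enough, both in order and in divisibility. -/
theorem ZMod.exists_addMonoidHom_apply_eq {p : ℕ} (hp : p.Prime) {l m c d : ℕ}
    {x : ZMod (p ^ l)} {y : ZMod (p ^ m)} (hx : addOrderOf x = p ^ c) (hy : p ^ d • y = 0)
    (hdc : d ≤ c) (hdl : d + l ≤ c + m) :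
    ∃ f : ZMod (p ^ l) →+ ZMod (p ^ m), f x = y := by
  obtain ⟨hcl, u, hu⟩ := ZMod.exists_unit_mul_of_addOrderOf_eq hp hx
  obtain ⟨e, hed, he⟩ := (Nat.dvd_prime_pow hp).1 (addOrderOf_dvd_of_nsmul_eq_zero hy)
  obtain ⟨hem, v, hv⟩ := ZMod.exists_unit_mul_of_addOrderOf_eq hp he
  have hpm : (p : ZMod (p ^ m)) ^ m = 0 := by rw [← Nat.cast_pow, ZMod.natCast_self]
  set w : ZMod (p ^ m) := (p : ZMod (p ^ m)) ^ (m - e - (l - c)) * v with hw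
  have hwl : zmultiplesHom (ZMod (p ^ m)) w ((p ^ l : ℕ) : ℤ) = 0 := by
    rw [zmultiplesHom_apply, natCast_zsmul, nsmul_eq_mul, hw, Nat.cast_pow, ← mul_assoc, ← pow_add,
      show l + (m - e - (l - c)) = m + (c - e) by omega, pow_add, hpm, zero_mul, zero_mul]
  refine ⟨(ZMod.lift (p ^ l) ⟨zmultiplesHom (ZMod (p ^ m)) w, hwl⟩).comp
    (AddMonoidHom.mulLeft (u⁻¹ : (ZMod (p ^ l))ˣ).val), ?_⟩
  have h1 : (u⁻¹ : (ZMod (p ^ l))ˣ).val * x = ((p ^ (l - c) : ℕ) : ℤ) := by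
    rw [hu, mul_left_comm, Units.inv_mul, mul_one]
    push_cast
    rfl
  rw [AddMonoidHom.comp_apply, AddMonoidHom.coe_mulLeft, h1, ZMod.lift_coe]
  change ((p ^ (l - c) : ℕ) : ℤ) • w = y
  rw [natCast_zsmul, nsmul_eq_mul, Nat.cast_pow, hw, ← mul_assoc, ← pow_add, hv]
  congr 2
  omega

theorem IsCanonical.le_and_add_le {n : ℕ} {lam a : Fin n → ℕ} (hcan : IsCanonical lam a)
    {i j : Fin n} (hij : i ≤ j) : a i ≤ a j ∧ a j + lam i ≤ a i + lam j := by
  obtain ⟨j, hj⟩ := j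
  induction j with
  | zero =>
    obtain rfl : i = ⟨0, hj⟩ := le_antisymm hij (Nat.zero_le _)
    exact ⟨le_rfl, le_rfl⟩
  | succ k ih =>
    rcases hij.eq_or_lt with rfl | h
    · exact ⟨le_rfl, le_rfl⟩
    · have h1 := ih (by omega) (Nat.lt_succ_iff.1 h)
      have h2 := hcan ⟨k, by omega⟩ ⟨k + 1, hj⟩ rfl
      omega

theorem IsCanonical.lt_of_not_degenAt {n : ℕ} {lam a : Fin n → ℕ} (hcan : IsCanonical lam a)
    {i j : Fin n} (hi : ¬ DegenAt lam a i) (hji : j < i) : a j < a i := by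
  have hlt : (j : ℕ) < i := hji
  let k : Fin n := ⟨i - 1, by omega⟩
  have hki : (k : ℕ) + 1 = i := by simp only [k]; omega
  have h1 := (hcan.le_and_add_le (i := j) (j := k) (by rw [Fin.le_def]; omega)).1
  have h2 := (hcan k i hki).1
  have h3 : a i ≠ a k := fun h => hi (Or.inr (Or.inl ⟨k, hki, h⟩))
  omega

theorem IsCanonical.add_lt_of_not_degenAt {n : ℕ} {lam a : Fin n → ℕ} (hcan : IsCanonical lam a)
    {i j : Fin n} (hi : ¬ DegenAt lam a i) (hij : i < j) : a j + lam i < a i + lam j := by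
  have hlt : (i : ℕ) < j := hij
  let k : Fin n := ⟨i + 1, by omega⟩
  have hik : (i : ℕ) + 1 = k := rfl
  have h1 := (hcan.le_and_add_le (i := k) (j := j) (by rw [Fin.le_def]; omega)).2
  have h2 := (hcan i k hik).2
  have h3 : a k + lam i ≠ a i + lam k := fun h => hi (Or.inr (Or.inr ⟨k, hik, h⟩))
  omega

/-- Every coordinate with a nonzero entry is dominated by a nondegenerate one. -/
theorem exists_not_degenAt {n : ℕ} {lam a : Fin n → ℕ} (hlam : StrictMono lam) (i : Fin n)
    (hi : a i ≠ 0) :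
    ∃ s, ¬ DegenAt lam a s ∧ a i ≤ a s ∧ a i + lam s ≤ a s + lam i := by
  obtain ⟨s, hs, hmax⟩ := Finset.exists_max_image
    {s | a i ≤ a s ∧ a i + lam s ≤ a s + lam i} (fun s => 2 * (a s : ℤ) - lam s) ⟨i, by simp⟩
  simp only [Finset.mem_filter, Finset.mem_univ, true_and] at hs hmax
  refine ⟨s, ?_, hs⟩
  rintro (⟨-, h⟩ | ⟨j, hj, h⟩ | ⟨j, hj, h⟩)
  · omega
  · have h1 : lam j < lam s := hlam (by rw [Fin.lt_def]; omega)
    have h2 := hmax j (by omega)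
    omega
  · have h1 : lam s < lam j := hlam (by rw [Fin.lt_def]; omega)
    have h2 := hmax j (by omega)
    omega

/-- A bound on the orders of the components of the image of an element of type `T(c)` under an
endomorphism. -/
theorem pow_nsmul_map_apply_eq_zero {p : ℕ} (hp : p.Prime) {n : ℕ} {lam c : Fin n → ℕ}
    (f : (Π i : Fin n, ZMod (p ^ lam i)) →+ Π i : Fin n, ZMod (p ^ lam i))
    {x : Π i : Fin n, ZMod (p ^ lam i)} (hx : ∀ i, addOrderOf (x i) = p ^ c i) {i : Fin n} {k : ℕ}
    (hle : ∀ j ≤ i, c j ≤ k) (hlt : ∀ j, i < j → c j + lam i ≤ k + lam j) :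
    p ^ k • f x i = 0 := by
  have hsum : f x i = ∑ j, f (Pi.single j (x j)) i := by
    conv_lhs => rw [← Finset.univ_sum_single x, map_sum, Finset.sum_apply]
  rw [hsum, Finset.smul_sum]
  refine Finset.sum_eq_zero fun j _ => ?_
  rcases le_or_gt j i with hji | hij
  · have h0 : p ^ k • x j = 0 := by
      rw [← addOrderOf_dvd_iff_nsmul_eq_zero, hx]
      exact pow_dvd_pow _ (hle j hji)
    rw [← Pi.smul_apply, ← map_nsmul, ← Pi.single_smul, h0, Pi.single_zero, map_zero, Pi.zero_apply]
  · obtain ⟨hcl, u, hu⟩ := ZMod.exists_unit_mul_of_addOrderOf_eq hp (hx j)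
    have hxj : x j = p ^ (lam j - c j) • (u : ZMod (p ^ lam j)) := by
      rw [hu, nsmul_eq_mul, Nat.cast_pow]
    have := hlt j hij
    rw [hxj, Pi.single_smul, map_nsmul, Pi.smul_apply, ← mul_smul, ← pow_add,
      show k + (lam j - c j) = (k + (lam j - c j) - lam i) + lam i by omega, pow_add, mul_smul]
    simp

theorem exists_forall_addOrderOf_eq {p : ℕ} (hp : p.Prime) {n : ℕ} {lam c : Fin n → ℕ}
    (hc : ∀ i, c i ≤ lam i) :
    ∃ x : Π i : Fin n, ZMod (p ^ lam i), ∀ i, addOrderOf (x i) = p ^ c i := by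
  refine ⟨fun i => ((p ^ (lam i - c i) : ℕ) : ZMod (p ^ lam i)), fun i => ?_⟩
  rw [ZMod.addOrderOf_coe _ (pow_ne_zero _ hp.ne_zero),
    Nat.gcd_eq_right (pow_dvd_pow _ (Nat.sub_le _ _)), Nat.pow_div (Nat.sub_le _ _) hp.pos]
  congr 1
  have := hc i
  omega

/-- The components of an automorphism carrying `g` to `h`: at nondegenerate coordinates it rescales
by a unit, at degenerate ones it adds a multiple of a dominating nondegenerate coordinate. -/
theorem exists_component_hom {p : ℕ} (hp : p.Prime) {n : ℕ} {lam a b : Fin n → ℕ}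
    (hlam : StrictMono lam) (hba : ∀ i, b i ≤ a i) (hnd : ∀ i, ¬ DegenAt lam a i → b i = a i)
    {g h : Π i : Fin n, ZMod (p ^ lam i)} (hg : ∀ i, addOrderOf (g i) = p ^ b i)
    (hh : ∀ i, addOrderOf (h i) = p ^ a i) (i : Fin n) :
    ∃ F : (Π i : Fin n, ZMod (p ^ lam i)) →+ ZMod (p ^ lam i), F g = h i ∧
      ∀ x, F x = 0 → (DegenAt lam a i → ∀ s, ¬ DegenAt lam a s → x s = 0) → x i = 0 := by
  by_cases hi : DegenAt lam a i
  · have hd : p ^ a i • (h i - g i) = 0 := by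
      rw [nsmul_sub, ← hh i, addOrderOf_nsmul_eq_zero, zero_sub, neg_eq_zero,
        ← addOrderOf_dvd_iff_nsmul_eq_zero, hg, hh]
      exact pow_dvd_pow _ (hba i)
    by_cases h0 : a i = 0
    · rw [h0, pow_zero, one_smul, sub_eq_zero] at hd
      exact ⟨Pi.evalAddMonoidHom _ i, hd.symm, fun x hx _ => hx⟩
    · obtain ⟨s, hs, hs1, hs2⟩ := exists_not_degenAt hlam i h0
      obtain ⟨f, hf⟩ := ZMod.exists_addMonoidHom_apply_eq hp (hnd s hs ▸ hg s) hd hs1 hs2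
      refine ⟨Pi.evalAddMonoidHom _ i + f.comp (Pi.evalAddMonoidHom (fun i => ZMod (p ^ lam i)) s),
        by simp [hf],
        fun x hx hx' => ?_⟩
      simpa [hx' hi s hs] using hx
  · obtain ⟨u, hu⟩ := ZMod.exists_unit_mul_eq hp (hnd i hi ▸ hg i) (hh i)
    exact ⟨(AddMonoidHom.mulLeft u.val).comp (Pi.evalAddMonoidHom _ i), hu,
      fun x hx _ => (Units.mul_right_eq_zero u).1 hx⟩

theorem stmt_11 (p : ℕ) (hp : p.Prime) (n : ℕ) (lam : Fin n → ℕ)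
    (hlam0 : ∀ i, 0 < lam i) (hlam : StrictMono lam)
    (a : Fin n → ℕ) (ha : ∀ i, a i ≤ lam i) (hcan : IsCanonical lam a)
    (b : Fin n → ℕ) (hb : ∀ i, b i ≤ lam i) :
    (∀ g h : Π i : Fin n, ZMod (p ^ lam i),
        (∀ i, addOrderOf (g i) = p ^ b i) → (∀ i, addOrderOf (h i) = p ^ a i) →
        ∃ φ : AddAut (Π i : Fin n, ZMod (p ^ lam i)), φ g = h) ↔
    ((∀ i, b i ≤ a i) ∧ ∀ i, ¬ DegenAt lam a i → b i = a i) := by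
  constructor
  · intro H
    obtain ⟨g, hg⟩ := exists_forall_addOrderOf_eq hp hb
    obtain ⟨h, hh⟩ := exists_forall_addOrderOf_eq hp ha
    obtain ⟨φ, hφ⟩ := H g h hg hh
    have hφ' : φ.symm h = g := by rw [← hφ]; exact φ.symm_apply_apply g
    have hba (i : Fin n) : b i ≤ a i := by
      have h0 := pow_nsmul_map_apply_eq_zero hp φ.symm.toAddMonoidHom hh (i := i) (k := a i)
        (fun j hj => (hcan.le_and_add_le hj).1) (fun j hj => (hcan.le_and_add_le hj.le).2)
      change p ^ a i • φ.symm h i = 0 at h0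
      rw [hφ', ← addOrderOf_dvd_iff_nsmul_eq_zero, hg] at h0
      exact (Nat.pow_dvd_pow_iff_le_right hp.one_lt).1 h0
    refine ⟨hba, fun i hi => (hba i).antisymm ?_⟩
    by_contra! hlt
    have h0 := pow_nsmul_map_apply_eq_zero hp φ.toAddMonoidHom hg (i := i) (k := a i - 1)
      (fun j hj => by
        rcases hj.eq_or_lt with rfl | hj
        · omega
        · have := hcan.lt_of_not_degenAt hi hj
          have := hba j
          omega)
      (fun j hj => by
        have := hcan.add_lt_of_not_degenAt hi hj
        have := hba j
        omega)
    change p ^ (a i - 1) • φ g i = 0 at h0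
    rw [hφ, ← addOrderOf_dvd_iff_nsmul_eq_zero, hh, Nat.pow_dvd_pow_iff_le_right hp.one_lt] at h0
    omega
  · rintro ⟨hba, hnd⟩ g h hg hh
    choose F hF hF0 using exists_component_hom hp hlam hba hnd hg hh
    have (i : Fin n) : NeZero (p ^ lam i) := ⟨pow_ne_zero _ hp.ne_zero⟩
    have hinj : Function.Injective (AddMonoidHom.pi F) := by
      rw [injective_iff_map_eq_zero]
      intro x hx
      have hx (i : Fin n) : F i x = 0 := congrFun hx i
      have hx' (s : Fin n) (hs : ¬ DegenAt lam a s) : x s = 0 :=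
        hF0 s x (hx s) fun hs' => absurd hs' hs
      exact funext fun i => hF0 i x (hx i) fun _ => hx'
    exact ⟨AddEquiv.ofBijective (AddMonoidHom.pi F) (Finite.injective_iff_bijective.1 hinj),
      funext hF⟩
end
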